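/- Let a > 0 be a real number and let γ_n(a) = ∫_{-1}^{1} ((C_n^{(a)}(x) - C_n^{(a)}(0))/x)^2 (1-x^2)^{a - 1/2} dx, where C_n^{(a)} is the Gegenbauer polynomial. Then for all n ≥ 2, γ_n(a) = π(n+a-1)Γ(n-1+2a) / (2^{2a-3} · n · n! · Γ(a)^2) + ((n+2a-2)^2/n^2) · γ_{n-2}(a), with initial conditions γ_0(a) = 0 and γ_1(a) = 4a√π·Γ(a+1/2)/Γ(a). -/

import Mathlib

open MeasureTheory Real

/-- The Gegenbauer polynomials `C_n^{(a)}`, defined by the recurrence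
`n C_n = 2x(n+a-1) C_{n-1} - (n+2a-2) C_{n-2}` with `C_0 = 1`, `C_1 = 2ax`. -/
noncomputable def gegenbauerC (a : ℝ) : ℕ → ℝ → ℝ
  | 0, _ => 1
  | 1, x => 2 * a * x
  | n + 2, x =>
      (2 * x * ((n : ℝ) + 1 + a) * gegenbauerC a (n + 1) x
        - ((n : ℝ) + 2 * a) * gegenbauerC a n x) / ((n : ℝ) + 2)

/-- `γ_n(a) = ∫_{-1}^1 ((C_n^{(a)}(x) - C_n^{(a)}(0))/x)^2 (1-x^2)^{a-1/2} dx`. -/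
noncomputable def gegenGamma (a : ℝ) (n : ℕ) : ℝ :=
  ∫ x in (-1 : ℝ)..1,
    ((gegenbauerC a n x - gegenbauerC a n 0) / x) ^ 2 * (1 - x ^ 2) ^ (a - 1 / 2)

lemma gegenbauerC_zero (a x : ℝ) : gegenbauerC a 0 x = 1 := by
  simp [gegenbauerC]

lemma gegenbauerC_one (a x : ℝ) : gegenbauerC a 1 x = 2 * a * x := by
  simp [gegenbauerC]

lemma gegenbauerC_add_two (a : ℝ) (n : ℕ) (x : ℝ) :
    gegenbauerC a (n + 2) x =
      (2 * x * ((n : ℝ) + 1 + a) * gegenbauerC a (n + 1) x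
        - ((n : ℝ) + 2 * a) * gegenbauerC a n x) / ((n : ℝ) + 2) := by
  rw [gegenbauerC]

@[fun_prop]
lemma continuous_gegenbauerC (a : ℝ) (n : ℕ) : Continuous (gegenbauerC a n) := by
  induction n using Nat.twoStepInduction with
  | zero =>
    rw [funext (gegenbauerC_zero a)]
    fun_prop
  | one =>
    rw [funext (gegenbauerC_one a)]
    fun_prop
  | more n h₀ h₁ =>
    rw [funext (gegenbauerC_add_two a n)]
    fun_prop

lemma hasDerivAt_gegenbauerC (a : ℝ) (n : ℕ) {x : ℝ} (hx : 1 - x ^ 2 ≠ 0) :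
    HasDerivAt (gegenbauerC a n)
      (((n + 2 * a) * x * gegenbauerC a n x - (n + 1) * gegenbauerC a (n + 1) x)
        / (1 - x ^ 2)) x := by
  induction n using Nat.twoStepInduction with
  | zero =>
    rw [funext (gegenbauerC_zero a), gegenbauerC_one]
    convert! hasDerivAt_const x (1 : ℝ) using 1
    simp
  | one =>
    rw [gegenbauerC_add_two, gegenbauerC_one, gegenbauerC_zero, funext (gegenbauerC_one a)]
    convert! (hasDerivAt_id x).const_mul (2 * a) using 1
    push_cast
    field_simp
    ring
  | more n h₀ h₁ =>
    have hn : (n : ℝ) + 2 ≠ 0 := by positivity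
    have hn' : (n : ℝ) + 3 ≠ 0 := by positivity
    have h := ((((hasDerivAt_id x).const_mul 2).mul_const ((n : ℝ) + 1 + a)).mul h₁).sub
      (h₀.const_mul ((n : ℝ) + 2 * a))
    have h := h.div_const ((n : ℝ) + 2)
    rw [funext (gegenbauerC_add_two a n)]
    convert! h using 1
    rw [gegenbauerC_add_two a (n + 1), gegenbauerC_add_two a n]
    push_cast
    simp only [id]
    field_simp
    ring

/-- The polynomial `(C_n^{(a)}(x) - C_n^{(a)}(0)) / x`. -/
noncomputable def gegenbauerQuot (a : ℝ) : ℕ → ℝ → ℝ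
  | 0, _ => 0
  | 1, _ => 2 * a
  | n + 2, x =>
      (2 * ((n : ℝ) + 1 + a) * gegenbauerC a (n + 1) x
        - ((n : ℝ) + 2 * a) * gegenbauerQuot a n x) / ((n : ℝ) + 2)

lemma gegenbauerQuot_zero (a x : ℝ) : gegenbauerQuot a 0 x = 0 := by
  simp [gegenbauerQuot]

lemma gegenbauerQuot_one (a x : ℝ) : gegenbauerQuot a 1 x = 2 * a := by
  simp [gegenbauerQuot]

lemma gegenbauerQuot_add_two (a : ℝ) (n : ℕ) (x : ℝ) :
    gegenbauerQuot a (n + 2) x =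
      (2 * ((n : ℝ) + 1 + a) * gegenbauerC a (n + 1) x
        - ((n : ℝ) + 2 * a) * gegenbauerQuot a n x) / ((n : ℝ) + 2) := by
  rw [gegenbauerQuot]

@[fun_prop]
lemma continuous_gegenbauerQuot (a : ℝ) (n : ℕ) : Continuous (gegenbauerQuot a n) := by
  induction n using Nat.twoStepInduction with
  | zero =>
    rw [funext (gegenbauerQuot_zero a)]
    fun_prop
  | one =>
    rw [funext (gegenbauerQuot_one a)]
    fun_prop
  | more n h₀ h₁ =>
    rw [funext (gegenbauerQuot_add_two a n)]
    fun_prop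

lemma gegenbauerC_sub_eval_zero (a : ℝ) (n : ℕ) (x : ℝ) :
    gegenbauerC a n x - gegenbauerC a n 0 = x * gegenbauerQuot a n x := by
  induction n using Nat.twoStepInduction with
  | zero => simp [gegenbauerC_zero, gegenbauerQuot_zero]
  | one => simp [gegenbauerC_one, gegenbauerQuot_one]; ring
  | more n h₀ h₁ =>
    have hn : (n : ℝ) + 2 ≠ 0 := by positivity
    rw [gegenbauerC_add_two, gegenbauerC_add_two, gegenbauerQuot_add_two]
    field_simp
    linear_combination -((n : ℝ) + 2 * a) * h₀

lemma mul_gegenbauerC_add_one {a : ℝ} (ha : 0 < a) (n : ℕ) (x : ℝ) :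
    x * gegenbauerC a (n + 1) x =
      ((n + 2) * gegenbauerC a (n + 2) x + (n + 2 * a) * gegenbauerC a n x)
        / (2 * (n + 1 + a)) := by
  have hn : (n : ℝ) + 2 ≠ 0 := by positivity
  have hn' : (n : ℝ) + 1 + a ≠ 0 := by positivity
  rw [gegenbauerC_add_two]
  field_simp
  ring

lemma intervalIntegrable_rpow_mul_one_sub_rpow {s : ℝ} (hs : -1 < s) :
    IntervalIntegrable (fun t : ℝ => t ^ s * (1 - t) ^ s) volume 0 1 := by
  have h := Complex.betaIntegral_convergent (u := (s + 1 : ℝ)) (v := (s + 1 : ℝ))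
    (by simp; linarith) (by simp; linarith)
  rw [intervalIntegrable_iff_integrableOn_Ioo_of_le zero_le_one] at h ⊢
  refine IntegrableOn.congr_fun (MeasureTheory.Integrable.re h) (fun t ht => ?_) measurableSet_Ioo
  obtain ⟨h0, h1⟩ := ht
  have e : (((s + 1 : ℝ) : ℂ) - 1) = (s : ℂ) := by push_cast; ring
  have e' : (1 - (t : ℂ)) = ((1 - t : ℝ) : ℂ) := by push_cast; ring
  simp only [e, e']
  rw [← Complex.ofReal_cpow h0.le, ← Complex.ofReal_cpow (by linarith), ← Complex.ofReal_mul]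
  simp

lemma integral_rpow_mul_one_sub_rpow {s : ℝ} (hs : -1 < s) :
    ∫ t in (0 : ℝ)..1, t ^ s * (1 - t) ^ s = Gamma (s + 1) ^ 2 / Gamma (2 * s + 2) := by
  have h := Complex.betaIntegral_eq_Gamma_mul_div (s + 1 : ℝ) (s + 1 : ℝ)
    (by simp; linarith) (by simp; linarith)
  have hb : Complex.betaIntegral (s + 1 : ℝ) (s + 1 : ℝ)
      = ((∫ t in (0 : ℝ)..1, t ^ s * (1 - t) ^ s : ℝ) : ℂ) := by
    rw [← intervalIntegral.integral_ofReal, Complex.betaIntegral]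
    refine intervalIntegral.integral_congr (fun t ht => ?_)
    rw [Set.uIcc_of_le zero_le_one] at ht
    obtain ⟨h0, h1⟩ := ht
    have e : (((s + 1 : ℝ) : ℂ) - 1) = (s : ℂ) := by push_cast; ring
    have e' : (1 - (t : ℂ)) = ((1 - t : ℝ) : ℂ) := by push_cast; ring
    simp only [e, e']
    rw [← Complex.ofReal_cpow h0, ← Complex.ofReal_cpow (by linarith), ← Complex.ofReal_mul]
  rw [hb, ← Complex.ofReal_add, Complex.Gamma_ofReal, Complex.Gamma_ofReal,
    ← Complex.ofReal_mul, ← Complex.ofReal_div, Complex.ofReal_inj] at h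
  rw [h]
  ring_nf

lemma one_sub_sq_rpow_eq {x : ℝ} (hx : x ∈ Set.Icc (-1 : ℝ) 1) (s : ℝ) :
    (1 - x ^ 2) ^ s
      = 4 ^ s * ((1 / 2 * x + 1 / 2) ^ s * (1 - (1 / 2 * x + 1 / 2)) ^ s) := by
  obtain ⟨h0, h1⟩ := hx
  rw [← mul_rpow (by linarith) (by linarith), ← mul_rpow (by norm_num) (by nlinarith)]
  congr 1
  ring

lemma intervalIntegrable_one_sub_sq_rpow {s : ℝ} (hs : -1 < s) :
    IntervalIntegrable (fun x : ℝ => (1 - x ^ 2) ^ s) volume (-1) 1 := by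
  have h := (((intervalIntegrable_rpow_mul_one_sub_rpow hs).comp_add_right (1 / 2)).comp_mul_left
    (c := 1 / 2)).const_mul (4 ^ s)
  norm_num only at h
  refine h.congr (fun x hx => ?_)
  rw [Set.uIoc_of_le (by norm_num)] at hx
  exact (one_sub_sq_rpow_eq ⟨hx.1.le, hx.2⟩ s).symm

lemma integral_one_sub_sq_rpow {s : ℝ} (hs : -1 < s) :
    ∫ x in (-1 : ℝ)..1, (1 - x ^ 2) ^ s
      = 2 * 4 ^ s * (Gamma (s + 1) ^ 2 / Gamma (2 * s + 2)) := by
  rw [← integral_rpow_mul_one_sub_rpow hs]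
  have h := intervalIntegral.integral_comp_mul_add (a := -1) (b := 1)
    (fun t : ℝ => t ^ s * (1 - t) ^ s) (c := 1 / 2) (by norm_num) (1 / 2)
  norm_num only at h
  rw [smul_eq_mul] at h
  rw [mul_comm (2 : ℝ), mul_assoc, ← h, ← intervalIntegral.integral_const_mul]
  refine intervalIntegral.integral_congr (fun x hx => ?_)
  rw [Set.uIcc_of_le (by norm_num)] at hx
  exact one_sub_sq_rpow_eq hx s

/-- The integral of `f` over `[-1, 1]` against the Gegenbauer weight `(1 - x ^ 2) ^ (a - 1 / 2)`. -/
noncomputable def gegenbauerIntegral (a : ℝ) (f : ℝ → ℝ) : ℝ :=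
  ∫ x in (-1 : ℝ)..1, f x * (1 - x ^ 2) ^ (a - 1 / 2)

lemma intervalIntegrable_mul_gegenbauer_weight {a : ℝ} (ha : 0 < a) {f : ℝ → ℝ}
    (hf : Continuous f) :
    IntervalIntegrable (fun x => f x * (1 - x ^ 2) ^ (a - 1 / 2)) volume (-1) 1 :=
  (intervalIntegrable_one_sub_sq_rpow (by linarith)).continuousOn_mul hf.continuousOn

lemma gegenbauerIntegral_add {a : ℝ} (ha : 0 < a) {f g : ℝ → ℝ} (hf : Continuous f)
    (hg : Continuous g) :
    gegenbauerIntegral a (fun x => f x + g x)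
      = gegenbauerIntegral a f + gegenbauerIntegral a g := by
  rw [gegenbauerIntegral, gegenbauerIntegral, gegenbauerIntegral,
    ← intervalIntegral.integral_add (intervalIntegrable_mul_gegenbauer_weight ha hf)
      (intervalIntegrable_mul_gegenbauer_weight ha hg)]
  simp only [add_mul]

lemma gegenbauerIntegral_const_mul (a c : ℝ) (f : ℝ → ℝ) :
    gegenbauerIntegral a (fun x => c * f x) = c * gegenbauerIntegral a f := by
  simp only [gegenbauerIntegral, mul_assoc, intervalIntegral.integral_const_mul]

lemma gegenbauerIntegral_eq_add {a : ℝ} (ha : 0 < a) {f g h : ℝ → ℝ} (c d : ℝ)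
    (hg : Continuous g) (hh : Continuous h) (H : ∀ x, f x = c * g x + d * h x) :
    gegenbauerIntegral a f = c * gegenbauerIntegral a g + d * gegenbauerIntegral a h := by
  rw [funext H, gegenbauerIntegral_add ha (by fun_prop) (by fun_prop),
    gegenbauerIntegral_const_mul, gegenbauerIntegral_const_mul]

lemma gegenbauerIntegral_eq_add_add {a : ℝ} (ha : 0 < a) {f g h k : ℝ → ℝ} (c d e : ℝ)
    (hg : Continuous g) (hh : Continuous h) (hk : Continuous k)
    (H : ∀ x, f x = c * g x + d * h x + e * k x) :
    gegenbauerIntegral a f = c * gegenbauerIntegral a g + d * gegenbauerIntegral a h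
      + e * gegenbauerIntegral a k := by
  rw [funext H, gegenbauerIntegral_add ha (by fun_prop) (by fun_prop),
    gegenbauerIntegral_const_mul, gegenbauerIntegral_eq_add ha c d hg hh fun _ => rfl]

lemma gegenbauerIntegral_one {a : ℝ} (ha : 0 < a) :
    gegenbauerIntegral a (fun _ => 1) = √π * Gamma (a + 1 / 2) / (a * Gamma a) := by
  have hd := Real.Gamma_mul_Gamma_add_half a
  set G := Gamma (a + 1 / 2) with hG'
  have h := integral_one_sub_sq_rpow (s := a - 1 / 2) (by linarith)
  have hG : Gamma (2 * a + 1) = 2 * a * Gamma (2 * a) := Gamma_add_one (by positivity)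
  have e₁ : a - 1 / 2 + 1 = a + 1 / 2 := by ring
  have e₂ : 2 * (a - 1 / 2) + 2 = 2 * a + 1 := by ring
  have e₃ : (4 : ℝ) ^ (a - 1 / 2) = (2 ^ (1 - 2 * a))⁻¹ := by
    rw [← rpow_neg (by norm_num), show (4 : ℝ) = 2 ^ (2 : ℝ) by norm_num,
      ← rpow_mul (by norm_num)]
    ring_nf
  have h2 : (2 : ℝ) ^ (1 - 2 * a) ≠ 0 := by positivity
  have hGa := (Gamma_pos_of_pos ha).ne'
  have hG2 := (Gamma_pos_of_pos (by positivity : 0 < 2 * a)).ne'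
  simp only [gegenbauerIntegral, one_mul]
  rw [h, e₁, e₂, hG, e₃, ← hG']
  field_simp
  linear_combination G * hd

lemma gegenbauerIntegral_derivation {a : ℝ} (ha : 0 < a) (n : ℕ) :
    (n - 1) * gegenbauerIntegral a (fun x => x * gegenbauerC a n x)
      = (n + 1) * gegenbauerIntegral a (gegenbauerC a (n + 1)) := by
  have key : gegenbauerIntegral a (fun x => (n - 1) * (x * gegenbauerC a n x)
      + -(n + 1) * gegenbauerC a (n + 1) x) = 0 := by
    have hder : ∀ x ∈ Set.Ioo (-1 : ℝ) 1,
        HasDerivAt (fun x => (1 - x ^ 2) ^ (a + 1 / 2) * gegenbauerC a n x)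
          (((n - 1) * (x * gegenbauerC a n x)
            + -(n + 1) * gegenbauerC a (n + 1) x) * (1 - x ^ 2) ^ (a - 1 / 2)) x := by
      intro x hx
      have hpos : 0 < 1 - x ^ 2 := by nlinarith [hx.1, hx.2]
      have h₁ : HasDerivAt (fun x : ℝ => 1 - x ^ 2) (-(2 * x)) x := by
        simpa using (hasDerivAt_pow 2 x).const_sub 1
      have h := (h₁.rpow_const (p := a + 1 / 2) (Or.inl hpos.ne')).mul
        (hasDerivAt_gegenbauerC a n hpos.ne')
      convert! h using 1
      have e₁ : (1 - x ^ 2) ^ (a + 1 / 2) = (1 - x ^ 2) * (1 - x ^ 2) ^ (a - 1 / 2) := by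
        rw [← rpow_one_add' hpos.le (by linarith)]
        ring_nf
      have e₂ : a + 1 / 2 - 1 = a - 1 / 2 := by ring
      rw [e₁, e₂]
      field_simp
      ring
    have hcont : ContinuousOn (fun x => (1 - x ^ 2) ^ (a + 1 / 2) * gegenbauerC a n x)
        (Set.Icc (-1 : ℝ) 1) := by
      have : Continuous fun x : ℝ => (1 - x ^ 2) ^ (a + 1 / 2) :=
        (by fun_prop : Continuous fun x : ℝ => 1 - x ^ 2).rpow_const
          fun _ => Or.inr (by positivity)
      fun_prop
    have h := intervalIntegral.integral_eq_sub_of_hasDerivAt_of_le (by norm_num) hcont hder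
      (intervalIntegrable_mul_gegenbauer_weight ha (by fun_prop))
    rw [gegenbauerIntegral, h]
    have h0 : a + 1 / 2 ≠ 0 := by positivity
    norm_num [zero_rpow h0]
  rw [gegenbauerIntegral_eq_add ha _ _ (by fun_prop) (by fun_prop) fun _ => rfl] at key
  linarith

lemma gegenbauerIntegral_gegenbauerC_eq_zero {a : ℝ} (ha : 0 < a) (n : ℕ) :
    gegenbauerIntegral a (gegenbauerC a (n + 1)) = 0 := by
  induction n using Nat.twoStepInduction with
  | zero =>
    have h := gegenbauerIntegral_derivation ha 0
    have h' := gegenbauerIntegral_const_mul a (2 * a) (fun x => x)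
    simp only [zero_add, gegenbauerC_zero, mul_one, funext (gegenbauerC_one a)] at h ⊢
    rw [h'] at h ⊢
    norm_num at h
    have : gegenbauerIntegral a (fun x => x) * (2 * a + 1) = 0 := by linarith
    rcases mul_eq_zero.1 this with h | h
    · rw [h, mul_zero]
    · linarith
  | one =>
    have h := gegenbauerIntegral_derivation ha 1
    norm_num at h
    exact h
  | more n h₀ h₁ =>
    have h := gegenbauerIntegral_derivation ha (n + 2)
    have h' := gegenbauerIntegral_eq_add ha _ _ (continuous_gegenbauerC a (n + 1 + 2))
      (continuous_gegenbauerC a (n + 1)) fun x => (mul_gegenbauerC_add_one ha (n + 1) x).trans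
        (by rw [add_div, mul_div_right_comm, mul_div_right_comm])
    rw [h', h₀] at h
    push_cast at h
    have hn : (n : ℝ) + 1 + 1 + a ≠ 0 := by positivity
    have hn' : ((n : ℝ) + 3) * (n + 3 + 2 * a) ≠ 0 := by positivity
    field_simp at h
    refine (mul_eq_zero.1 ?_).resolve_left hn'
    linear_combination -h

lemma gegenbauerC_add_two_mul {a : ℝ} (ha : 0 < a) (m n : ℕ) (x : ℝ) :
    gegenbauerC a (m + 2) x * gegenbauerC a (n + 1) x =
      (m + 1 + a) * (n + 2) / ((m + 2) * (n + 1 + a))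
          * (gegenbauerC a (m + 1) x * gegenbauerC a (n + 2) x)
        + (m + 1 + a) * (n + 2 * a) / ((m + 2) * (n + 1 + a))
          * (gegenbauerC a (m + 1) x * gegenbauerC a n x)
        + -(m + 2 * a) / (m + 2) * (gegenbauerC a m x * gegenbauerC a (n + 1) x) := by
  have h := mul_gegenbauerC_add_one ha n x
  have hm : (m : ℝ) + 2 ≠ 0 := by positivity
  have hn : (n : ℝ) + 1 + a ≠ 0 := by positivity
  rw [gegenbauerC_add_two a m]
  field_simp at h ⊢
  linear_combination (m + 1 + a) * gegenbauerC a (m + 1) x * h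

lemma gegenbauerC_one_mul {a : ℝ} (ha : 0 < a) (n : ℕ) (x : ℝ) :
    gegenbauerC a 1 x * gegenbauerC a (n + 1) x =
      a * (n + 2) / (n + 1 + a) * gegenbauerC a (n + 2) x
        + a * (n + 2 * a) / (n + 1 + a) * gegenbauerC a n x := by
  have h := mul_gegenbauerC_add_one ha n x
  have hn : (n : ℝ) + 1 + a ≠ 0 := by positivity
  rw [gegenbauerC_one]
  field_simp at h ⊢
  linear_combination h

lemma gegenbauerIntegral_mul_eq_zero {a : ℝ} (ha : 0 < a) (m n : ℕ) (hmn : m < n) :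
    gegenbauerIntegral a (fun x => gegenbauerC a m x * gegenbauerC a n x) = 0 := by
  induction m using Nat.twoStepInduction generalizing n with
  | zero =>
    obtain ⟨n, rfl⟩ := Nat.exists_eq_add_of_lt hmn
    simp only [gegenbauerC_zero, one_mul, zero_add]
    exact gegenbauerIntegral_gegenbauerC_eq_zero ha n
  | one =>
    obtain ⟨n, rfl⟩ := Nat.exists_eq_add_of_le' hmn
    rw [gegenbauerIntegral_eq_add ha _ _ (by fun_prop) (by fun_prop)
      (gegenbauerC_one_mul ha (n + 1)), gegenbauerIntegral_gegenbauerC_eq_zero ha,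
      gegenbauerIntegral_gegenbauerC_eq_zero ha]
    ring
  | more m h₀ h₁ =>
    obtain ⟨n, rfl⟩ := Nat.exists_eq_add_of_le' (Nat.one_le_of_lt hmn)
    rw [gegenbauerIntegral_eq_add_add ha _ _ _ (by fun_prop) (by fun_prop) (by fun_prop)
      (gegenbauerC_add_two_mul ha m n), h₁ _ (by omega), h₁ _ (by omega), h₀ _ (by omega)]
    ring

lemma gegenbauerIntegral_sq_add_one {a : ℝ} (ha : 0 < a) (n : ℕ) :
    gegenbauerIntegral a (fun x => gegenbauerC a (n + 1) x * gegenbauerC a (n + 1) x)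
      = (n + a) * (n + 2 * a) / ((n + 1) * (n + 1 + a))
        * gegenbauerIntegral a (fun x => gegenbauerC a n x * gegenbauerC a n x) := by
  cases n with
  | zero =>
    rw [gegenbauerIntegral_eq_add ha _ _ (by fun_prop) (by fun_prop) (gegenbauerC_one_mul ha 0),
      gegenbauerIntegral_gegenbauerC_eq_zero ha]
    simp only [gegenbauerC_zero, funext (gegenbauerC_zero a)]
    push_cast
    ring_nf
  | succ n =>
    rw [gegenbauerIntegral_eq_add_add ha _ _ _ (by fun_prop) (by fun_prop) (by fun_prop)
      (gegenbauerC_add_two_mul ha n (n + 1)),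
      gegenbauerIntegral_mul_eq_zero ha (n + 1) (n + 1 + 2) (by omega),
      gegenbauerIntegral_mul_eq_zero ha n (n + 1 + 1) (by omega)]
    push_cast
    ring_nf

lemma gegenbauerIntegral_sq {a : ℝ} (ha : 0 < a) (n : ℕ) :
    gegenbauerIntegral a (fun x => gegenbauerC a n x * gegenbauerC a n x)
      = π * Gamma (n + 2 * a)
        / (2 ^ (2 * a - 1) * n.factorial * (n + a) * Gamma a ^ 2) := by
  have hGa := (Gamma_pos_of_pos ha).ne'
  have h2 : (2 : ℝ) ^ (2 * a - 1) ≠ 0 := by positivity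
  induction n with
  | zero =>
    simp only [gegenbauerC_zero, mul_one]
    rw [gegenbauerIntegral_one ha]
    have hd := Real.Gamma_mul_Gamma_add_half a
    rw [show 1 - 2 * a = -(2 * a - 1) by ring, rpow_neg (by norm_num)] at hd
    have hp : √π * √π = π := mul_self_sqrt pi_pos.le
    simp only [Nat.cast_zero, zero_add, Nat.factorial_zero, Nat.cast_one, mul_one]
    field_simp at hd ⊢
    linear_combination √π * hd + Gamma (a * 2) * hp
  | succ n ih =>
    have hn : (n : ℝ) + a ≠ 0 := by positivity
    have hn' : (n : ℝ) + 1 + a ≠ 0 := by positivity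
    have hG : Gamma ((n : ℝ) + 1 + 2 * a) = (n + 2 * a) * Gamma (n + 2 * a) := by
      rw [← Gamma_add_one (by positivity)]
      ring_nf
    rw [gegenbauerIntegral_sq_add_one ha, ih, Nat.factorial_succ]
    push_cast
    rw [hG]
    field_simp

lemma gegenbauerIntegral_mul_gegenbauerQuot {a : ℝ} (ha : 0 < a) (m n : ℕ) (hmn : m ≤ n) :
    gegenbauerIntegral a (fun x => gegenbauerC a n x * gegenbauerQuot a m x) = 0 := by
  induction m using Nat.twoStepInduction with
  | zero => simp [gegenbauerQuot_zero, gegenbauerIntegral]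
  | one =>
    obtain ⟨n, rfl⟩ := Nat.exists_eq_add_of_le' hmn
    simp only [gegenbauerQuot_one, mul_comm _ (2 * a)]
    rw [gegenbauerIntegral_const_mul, gegenbauerIntegral_gegenbauerC_eq_zero ha, mul_zero]
  | more m h₀ h₁ =>
    have hm : (m : ℝ) + 2 ≠ 0 := by positivity
    rw [gegenbauerIntegral_eq_add ha (g := fun x => gegenbauerC a (m + 1) x * gegenbauerC a n x)
      (h := fun x => gegenbauerC a n x * gegenbauerQuot a m x)
      (2 * (m + 1 + a) / (m + 2)) (-(m + 2 * a) / (m + 2)) (by fun_prop) (by fun_prop),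
      gegenbauerIntegral_mul_eq_zero ha _ _ (by omega), h₀ (by omega)]
    · ring
    · intro x
      rw [gegenbauerQuot_add_two]
      field_simp
      ring

lemma gegenGamma_eq_gegenbauerIntegral (a : ℝ) (n : ℕ) :
    gegenGamma a n
      = gegenbauerIntegral a (fun x => gegenbauerQuot a n x * gegenbauerQuot a n x) := by
  rw [gegenGamma, gegenbauerIntegral]
  refine intervalIntegral.integral_congr_ae ?_
  filter_upwards [Measure.ae_ne volume 0] with x hx _
  rw [gegenbauerC_sub_eval_zero, mul_div_cancel_left₀ _ hx, sq]

lemma gegenGamma_add_two {a : ℝ} (ha : 0 < a) (n : ℕ) :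
    gegenGamma a (n + 2)
      = 4 * (n + 1 + a) ^ 2 / (n + 2) ^ 2
          * gegenbauerIntegral a (fun x => gegenbauerC a (n + 1) x * gegenbauerC a (n + 1) x)
        + (n + 2 * a) ^ 2 / (n + 2) ^ 2 * gegenGamma a n := by
  have hn : (n : ℝ) + 2 ≠ 0 := by positivity
  rw [gegenGamma_eq_gegenbauerIntegral, gegenGamma_eq_gegenbauerIntegral,
    gegenbauerIntegral_eq_add_add ha
      (g := fun x => gegenbauerC a (n + 1) x * gegenbauerC a (n + 1) x)
      (h := fun x => gegenbauerQuot a n x * gegenbauerQuot a n x)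
      (k := fun x => gegenbauerC a (n + 1) x * gegenbauerQuot a n x)
      (4 * (n + 1 + a) ^ 2 / (n + 2) ^ 2) ((n + 2 * a) ^ 2 / (n + 2) ^ 2)
      (-(4 * (n + 1 + a) * (n + 2 * a)) / (n + 2) ^ 2)
      (by fun_prop) (by fun_prop) (by fun_prop),
    gegenbauerIntegral_mul_gegenbauerQuot ha _ _ (by omega)]
  · ring
  · intro x
    rw [gegenbauerQuot_add_two]
    field_simp
    ring

theorem gegenbauer_gamma_recurrence (a : ℝ) (ha : 0 < a) :
    gegenGamma a 0 = 0 ∧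
    gegenGamma a 1 = 4 * a * Real.sqrt π * Real.Gamma (a + 1 / 2) / Real.Gamma a ∧
    ∀ n : ℕ, 2 ≤ n →
      gegenGamma a n
        = π * ((n : ℝ) + a - 1) * Real.Gamma ((n : ℝ) - 1 + 2 * a)
            / ((2 : ℝ) ^ (2 * a - 3) * (n : ℝ) * (n.factorial : ℝ) * Real.Gamma a ^ 2)
          + (((n : ℝ) + 2 * a - 2) ^ 2 / (n : ℝ) ^ 2) * gegenGamma a (n - 2) := by
  refine ⟨by simp [gegenGamma, gegenbauerC_zero], ?_, fun n hn => ?_⟩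
  · rw [gegenGamma_eq_gegenbauerIntegral]
    simp only [gegenbauerQuot_one]
    have h := gegenbauerIntegral_const_mul a (2 * a * (2 * a)) (fun _ => 1)
    simp only [mul_one] at h
    have hGa := (Gamma_pos_of_pos ha).ne'
    rw [h, gegenbauerIntegral_one ha]
    field_simp
    ring
  · obtain ⟨n, rfl⟩ := Nat.exists_eq_add_of_le' hn
    have hGa := (Gamma_pos_of_pos ha).ne'
    have hn' : (n : ℝ) + 1 + a ≠ 0 := by positivity
    have h2 : (2 : ℝ) ^ (2 * a - 1) = 4 * 2 ^ (2 * a - 3) := by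
      rw [show 2 * a - 1 = 2 + (2 * a - 3) by ring, rpow_add (by norm_num)]
      norm_num
    have hf : ((n + 2).factorial : ℝ) = (n + 2) * (n + 1).factorial := by
      rw [Nat.factorial_succ]
      push_cast
      ring
    rw [gegenGamma_add_two ha, gegenbauerIntegral_sq ha, h2, hf, Nat.add_sub_cancel]
    push_cast
    rw [show (n : ℝ) + 2 + a - 1 = n + 1 + a by ring,
      show (n : ℝ) + 2 - 1 + 2 * a = n + 1 + 2 * a by ring,
      show (n : ℝ) + 2 + 2 * a - 2 = n + 2 * a by ring]
    field_simp
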